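/- Let A be a commutative noetherian ring, m ⊆ A a maximal ideal, and {F_i}_{i ∈ I} a set-indexed family of cochain complexes of flat A-modules. Then the complexes (∏_{i ∈ I} F_i) ⊗_A E(A/m) and Γ_m(∏_{i ∈ I} (F_i ⊗_A E(A/m))) are homotopy equivalent, where the products are taken degreewise. -/

import Mathlib

universe u

/-- `E` is an injective hull (injective envelope) of the `A`-module `M`: `E` is injective and
admits an essential monomorphism from `M`. -/
def IsInjectiveHull (A : Type u) [CommRing A] (M E : Type u) [AddCommGroup M] [Module A M]
    [AddCommGroup E] [Module A E] : Prop :=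
  Module.Injective A E ∧
    ∃ ι : M →ₗ[A] E, Function.Injective ι ∧
      ∀ N : Submodule A E, N ≠ ⊥ → N ⊓ LinearMap.range ι ≠ ⊥

/-- The `m`-torsion submodule `Γ_m(M) = { x ∈ M | mⁿ x = 0 for some n }`. -/
def torsionAt (A : Type u) [CommRing A] (m : Ideal A) (M : Type u) [AddCommGroup M]
    [Module A M] : Submodule A M where
  carrier := {x | ∃ n : ℕ, ∀ a ∈ m ^ n, a • x = 0}
  zero_mem' := ⟨0, fun a _ => smul_zero a⟩
  add_mem' := by
    rintro x y ⟨n, hn⟩ ⟨k, hk⟩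
    refine ⟨max n k, fun a ha => ?_⟩
    rw [smul_add, hn a (Ideal.pow_le_pow_right (le_max_left n k) ha),
      hk a (Ideal.pow_le_pow_right (le_max_right n k) ha), add_zero]
  smul_mem' := by
    rintro c x ⟨n, hn⟩
    exact ⟨n, fun a ha => by rw [smul_comm, hn a ha, smul_zero]⟩

lemma mem_torsionAt (A : Type u) [CommRing A] (m : Ideal A) {M : Type u} [AddCommGroup M]
    [Module A M] {x : M} :
    x ∈ torsionAt A m M ↔ ∃ n : ℕ, ∀ a ∈ m ^ n, a • x = 0 := Iff.rfl

/-- The map `Γ_m(M) → Γ_m(N)` induced by a linear map `M → N`. -/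
noncomputable def gammaMap (A : Type u) [CommRing A] (m : Ideal A) {M N : Type u}
    [AddCommGroup M] [Module A M] [AddCommGroup N] [Module A N] (f : M →ₗ[A] N) :
    torsionAt A m M →ₗ[A] torsionAt A m N :=
  f.restrict (p := torsionAt A m M) (q := torsionAt A m N) (fun x hx => by
    obtain ⟨n, hn⟩ := (mem_torsionAt A m).1 hx
    exact (mem_torsionAt A m).2 ⟨n, fun a ha => by rw [← map_smul, hn a ha, map_zero]⟩)

/-- A chain map between two cochain complexes of `A`-modules. -/
def IsChainMap (A : Type u) [CommRing A]
    (X : ℤ → Type u) [∀ n, AddCommGroup (X n)] [∀ n, Module A (X n)]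
    (dX : ∀ n, X n →ₗ[A] X (n + 1))
    (Y : ℤ → Type u) [∀ n, AddCommGroup (Y n)] [∀ n, Module A (Y n)]
    (dY : ∀ n, Y n →ₗ[A] Y (n + 1))
    (f : ∀ n, X n →ₗ[A] Y n) : Prop :=
  ∀ n (x : X n), f (n + 1) (dX n x) = dY n (f n x)

/-- Two chain maps are chain homotopic. -/
def ChainHomotopic (A : Type u) [CommRing A]
    (X : ℤ → Type u) [∀ n, AddCommGroup (X n)] [∀ n, Module A (X n)]
    (dX : ∀ n, X n →ₗ[A] X (n + 1))
    (Y : ℤ → Type u) [∀ n, AddCommGroup (Y n)] [∀ n, Module A (Y n)]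
    (dY : ∀ n, Y n →ₗ[A] Y (n + 1))
    (f g : ∀ n, X n →ₗ[A] Y n) : Prop :=
  ∃ s : ∀ n, X (n + 1) →ₗ[A] Y n,
    ∀ n (x : X (n + 1)),
      f (n + 1) x - g (n + 1) x = dY n (s n x) + s (n + 1) (dX (n + 1) x)

section Complexes

variable (A : Type u) [CommRing A] (m : Ideal A)
variable (ι : Type u) (F : ι → ℤ → Type u) [∀ i n, AddCommGroup (F i n)]
  [∀ i n, Module A (F i n)] (d : ∀ i n, F i n →ₗ[A] F i (n + 1))
variable (E : Type u) [AddCommGroup E] [Module A E]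

/-- Degree `n` part of the complex `(∏ᵢ Fᵢ) ⊗_A E`. -/
noncomputable def prodTensorObj (n : ℤ) : Type u :=
  TensorProduct A (∀ i, F i n) E

noncomputable instance (n : ℤ) : AddCommGroup (prodTensorObj A ι F E n) :=
  inferInstanceAs (AddCommGroup (TensorProduct A (∀ i, F i n) E))

noncomputable instance (n : ℤ) : Module A (prodTensorObj A ι F E n) :=
  inferInstanceAs (Module A (TensorProduct A (∀ i, F i n) E))

/-- Differential of the complex `(∏ᵢ Fᵢ) ⊗_A E`. -/
noncomputable def prodTensorD (n : ℤ) :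
    prodTensorObj A ι F E n →ₗ[A] prodTensorObj A ι F E (n + 1) :=
  LinearMap.rTensor E (LinearMap.pi fun i => (d i n) ∘ₗ LinearMap.proj i)

/-- Degree `n` part of the complex `Γ_m (∏ᵢ (Fᵢ ⊗_A E))`. -/
noncomputable def gammaProdObj (n : ℤ) : Type u :=
  ↥(torsionAt A m (∀ i, TensorProduct A (F i n) E))

noncomputable instance (n : ℤ) : AddCommGroup (gammaProdObj A m ι F E n) :=
  inferInstanceAs (AddCommGroup ↥(torsionAt A m (∀ i, TensorProduct A (F i n) E)))

noncomputable instance (n : ℤ) : Module A (gammaProdObj A m ι F E n) :=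
  inferInstanceAs (Module A ↥(torsionAt A m (∀ i, TensorProduct A (F i n) E)))

/-- Differential of the complex `Γ_m (∏ᵢ (Fᵢ ⊗_A E))`. -/
noncomputable def gammaProdD (n : ℤ) :
    gammaProdObj A m ι F E n →ₗ[A] gammaProdObj A m ι F E (n + 1) :=
  gammaMap A m (LinearMap.pi fun i => (LinearMap.rTensor E (d i n)) ∘ₗ LinearMap.proj i)

end Complexes

open scoped TensorProduct

section Aux

variable {A : Type u} [CommRing A]

lemma aux_torsion [IsNoetherianRing A] (m : Ideal A)
    {E : Type u} [AddCommGroup E] [Module A E] (hE : IsInjectiveHull A (A ⧸ m) E) (e : E) :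
    ∃ n : ℕ, ∀ a ∈ m ^ n, a • e = 0 := by
  obtain ⟨-, j, -, hess⟩ := hE
  have key : m ≤ (Module.annihilator A (Submodule.span A {e})).radical := by
    intro a ha
    let f : ℕ →o Ideal A :=
      ⟨fun n => LinearMap.ker (LinearMap.toSpanSingleton A E (a ^ n • e)), by
        intro p q hpq x hx
        simp only [LinearMap.mem_ker, LinearMap.toSpanSingleton_apply] at hx ⊢
        obtain ⟨k, rfl⟩ := Nat.exists_eq_add_of_le hpq
        rw [pow_add, mul_comm, mul_smul, smul_comm, hx, smul_zero]⟩
    obtain ⟨n, hn⟩ := monotone_stabilizes_iff_noetherian.mpr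
      (inferInstance : IsNoetherian A A) f
    refine ⟨n, ?_⟩
    rw [Submodule.mem_annihilator_span_singleton]
    by_contra hne
    have h1 := hess (Submodule.span A {a ^ n • e}) (by
      rwa [Ne, Submodule.span_singleton_eq_bot])
    obtain ⟨y, hy, hy0⟩ := Submodule.exists_mem_ne_zero_of_ne_bot h1
    obtain ⟨hy1, ⟨z, rfl⟩⟩ := hy
    obtain ⟨b, hb⟩ := Submodule.mem_span_singleton.1 hy1
    have haz : a • z = 0 := by
      obtain ⟨w, rfl⟩ := Ideal.Quotient.mk_surjective z
      have : a • (Ideal.Quotient.mk m w) = Ideal.Quotient.mk m (a * w) := rfl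
      rw [this, Ideal.Quotient.eq_zero_iff_mem]
      exact Ideal.mul_mem_right _ _ ha
    have hb1 : b ∈ f (n + 1) := by
      change b • (a ^ (n + 1) • e) = 0
      rw [pow_succ', mul_smul, smul_comm, hb, ← map_smul, haz, map_zero]
    rw [← hn (n + 1) (Nat.le_succ n)] at hb1
    have hb2 : b • (a ^ n • e) = 0 := hb1
    exact hy0 (by rw [← hb, hb2])
  obtain ⟨n, hn⟩ := Ideal.exists_pow_le_of_le_radical_of_fg key (IsNoetherian.noetherian m)
  exact ⟨n, fun a ha => (Submodule.mem_annihilator_span_singleton _ _).1 (hn ha)⟩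

/-- elements killed by `m ^ n` -/
def killed (m : Ideal A) (E : Type u) [AddCommGroup E] [Module A E] (n : ℕ) : Submodule A E where
  carrier := {x | ∀ a ∈ m ^ n, a • x = 0}
  zero_mem' := fun a _ => smul_zero a
  add_mem' := fun hx hy a ha => by rw [smul_add, hx a ha, hy a ha, add_zero]
  smul_mem' := fun c x hx a ha => by rw [smul_comm, hx a ha, smul_zero]

lemma killed_mono (m : Ideal A) (E : Type u) [AddCommGroup E] [Module A E] :
    Monotone (killed m E) :=
  fun _ _ h _ hx a ha => hx a (Ideal.pow_le_pow_right h ha)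

/-- multiplication by a tuple -/
def mulTuple {r : ℕ} (c : Fin r → A) (E : Type u) [AddCommGroup E] [Module A E] :
    E →ₗ[A] (Fin r → E) := LinearMap.pi fun k => LinearMap.lsmul A E (c k)

lemma killed_of_gen {E : Type u} [AddCommGroup E] [Module A E] {r : ℕ} (c : Fin r → A) (x : E)
    (h : ∀ k, c k • x = 0) (a : A) (ha : a ∈ Ideal.span (Set.range c)) : a • x = 0 := by
  induction ha using Submodule.span_induction with
  | mem a ha => obtain ⟨k, rfl⟩ := ha; exact h k
  | zero => exact zero_smul _ _
  | add a b _ _ h1 h2 => rw [add_smul, h1, h2, add_zero]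
  | smul b a _ h1 => rw [smul_assoc, h1, smul_zero]

lemma killed_fg [IsNoetherianRing A] (m : Ideal A) (hm : m.IsMaximal)
    {E : Type u} [AddCommGroup E] [Module A E] (hE : IsInjectiveHull A (A ⧸ m) E) (n : ℕ) :
    (killed m E n).FG := by
  induction n with
  | zero =>
    have : killed m E 0 = ⊥ := by
      rw [eq_bot_iff]
      intro x hx
      have := hx 1 (by simp)
      simpa using this
    rw [this]; exact Submodule.fg_bot
  | succ n ih =>
    obtain ⟨r, c, hc⟩ := Submodule.fg_iff_exists_fin_generating_family.1
      (IsNoetherian.noetherian m)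
    have hcm : ∀ k, c k ∈ m := fun k => hc ▸ Submodule.subset_span ⟨k, rfl⟩
    refine Submodule.fg_of_fg_map_of_fg_inf_ker (mulTuple c E) ?_ ?_
    · have : IsNoetherian A (killed m E n) := isNoetherian_of_fg_of_noetherian _ ih
      let g : (Fin r → killed m E n) →ₗ[A] (Fin r → E) :=
        LinearMap.pi fun k => (killed m E n).subtype ∘ₗ LinearMap.proj k
      have h1 : (LinearMap.range g).FG := by
        rw [LinearMap.range_eq_map]
        exact (IsNoetherian.noetherian (⊤ : Submodule A (Fin r → killed m E n))).map g
      have : IsNoetherian A (LinearMap.range g) := isNoetherian_of_fg_of_noetherian _ h1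
      refine isNoetherian_submodule.1 (inferInstance : (IsNoetherian A (LinearMap.range g))) _ ?_
      rintro _ ⟨x, hx, rfl⟩
      refine ⟨fun k => ⟨c k • x, fun b hb => ?_⟩, rfl⟩
      rw [← mul_smul]
      exact hx _ (by rw [pow_succ]; exact Ideal.mul_mem_mul hb (hcm k))
    · obtain ⟨-, j, -, hess⟩ := hE
      have h1 : (LinearMap.range j).FG := by
        rw [LinearMap.range_eq_map]
        exact (IsNoetherian.noetherian (⊤ : Submodule A (A ⧸ m))).map j
      have : IsNoetherian A (LinearMap.range j) := isNoetherian_of_fg_of_noetherian _ h1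
      refine isNoetherian_submodule.1 (inferInstance : (IsNoetherian A (LinearMap.range j))) _ ?_
      rintro x ⟨-, hx⟩
      have hx' : ∀ a ∈ m, a • x = 0 := fun a ha =>
        killed_of_gen c x (fun k => congrFun hx k) a (by rw [← hc] at ha; exact ha)
      by_cases h0 : x = 0
      · rw [h0]; exact zero_mem _
      have h2 := hess (Submodule.span A {x}) (by rwa [Ne, Submodule.span_singleton_eq_bot])
      obtain ⟨y, ⟨hy1, hy2⟩, hy0⟩ := Submodule.exists_mem_ne_zero_of_ne_bot h2
      obtain ⟨b, rfl⟩ := Submodule.mem_span_singleton.1 hy1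
      have hb : b ∉ m := fun hb => hy0 (hx' b hb)
      obtain ⟨t, i, hi, hti⟩ := hm.exists_inv hb
      have : x = t • (b • x) := by
        calc x = (t * b + i) • x := by rw [hti, one_smul]
          _ = _ := by rw [add_smul, hx' i hi, add_zero, mul_smul]
      rw [this]
      exact Submodule.smul_mem _ _ hy2

lemma flat_killed [IsNoetherianRing A] (m : Ideal A) (n : ℕ)
    (E : Type u) [AddCommGroup E] [Module A E] (F : Type u) [AddCommGroup F] [Module A F]
    [Module.Flat A F] (x : TensorProduct A F E) (hx : ∀ a ∈ m ^ n, a • x = 0) :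
    ∃ y, LinearMap.lTensor F (killed m E n).subtype y = x := by
  obtain ⟨r, c, hc⟩ := Submodule.fg_iff_exists_fin_generating_family.1
    (IsNoetherian.noetherian (m ^ n))
  have hcm : ∀ k, c k ∈ m ^ n := fun k => hc ▸ Submodule.subset_span ⟨k, rfl⟩
  have hex : Function.Exact (killed m E n).subtype (mulTuple c E) := by
    intro e
    constructor
    · intro he
      refine ⟨⟨e, fun a ha => killed_of_gen c e (fun k => congrFun he k) a ?_⟩, rfl⟩
      rw [← hc] at ha; exact ha
    · rintro ⟨⟨e, he⟩, rfl⟩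
      ext k
      exact he _ (hcm k)
  have hex2 := Module.Flat.lTensor_exact F hex
  refine (hex2 x).1 ?_
  apply (TensorProduct.piRight A A F (fun _ : Fin r => E)).injective
  rw [map_zero]
  ext k
  have : ∀ z : TensorProduct A F E, TensorProduct.piRight A A F (fun _ : Fin r => E)
      (LinearMap.lTensor F (mulTuple c E) z) k = c k • z := by
    intro z
    induction z using TensorProduct.induction_on with
    | zero => simp
    | tmul f e => simp [mulTuple]
    | add a b ha hb => rw [map_add, map_add, Pi.add_apply, ha, hb, smul_add]
  rw [this, hx _ (hcm k)]; rfl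

/-- the canonical map `(∏ Gᵢ) ⊗ N → ∏ (Gᵢ ⊗ N)` -/
noncomputable def canMap {ι : Type u} (G : ι → Type u) [∀ i, AddCommGroup (G i)]
    [∀ i, Module A (G i)] (N : Type u) [AddCommGroup N] [Module A N] :
    TensorProduct A (∀ i, G i) N →ₗ[A] ∀ i, TensorProduct A (G i) N :=
  LinearMap.pi fun i => LinearMap.rTensor N (LinearMap.proj i)

section
variable {ι : Type u} (G : ι → Type u) [∀ i, AddCommGroup (G i)] [∀ i, Module A (G i)]

lemma canMap_nat {N P : Type u} [AddCommGroup N] [Module A N] [AddCommGroup P] [Module A P]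
    (f : N →ₗ[A] P) (x : TensorProduct A (∀ i, G i) N) (i : ι) :
    canMap (A := A) G P (LinearMap.lTensor _ f x) i = LinearMap.lTensor _ f (canMap (A := A) G N x i) := by
  induction x using TensorProduct.induction_on with
  | zero => simp
  | tmul f e => rfl
  | add a b ha hb => simp only [map_add, Pi.add_apply, ha, hb]

lemma canMap_free (r : ℕ) : Function.Bijective (canMap (A := A) G (ULift.{u} (Fin r) → A)) := by
  have h : ∀ x i k, TensorProduct.piScalarRight A A (G i) (ULift.{u} (Fin r))
      (canMap (A := A) G (ULift.{u} (Fin r) → A) x i) k =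
      TensorProduct.piScalarRight A A (∀ i, G i) (ULift.{u} (Fin r)) x k i := by
    intro x i k
    induction x using TensorProduct.induction_on with
    | zero => simp
    | tmul f e => simp [canMap]
    | add a b ha hb => simp only [map_add, Pi.add_apply, ha, hb]
  constructor
  · intro x y hxy
    apply (TensorProduct.piScalarRight A A (∀ i, G i) (ULift.{u} (Fin r))).injective
    ext k i
    rw [← h, ← h, hxy]
  · intro y
    refine ⟨(TensorProduct.piScalarRight A A (∀ i, G i) (ULift.{u} (Fin r))).symm
      (fun k i => TensorProduct.piScalarRight A A (G i) (ULift.{u} (Fin r)) (y i) k), ?_⟩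
    ext i
    apply (TensorProduct.piScalarRight A A (G i) (ULift.{u} (Fin r))).injective
    ext k
    rw [h, LinearEquiv.apply_symm_apply]

lemma exists_free_surj (N : Type u) [AddCommGroup N] [Module A N] [Module.Finite A N] :
    ∃ (r : ℕ) (f : (ULift.{u} (Fin r) → A) →ₗ[A] N), Function.Surjective f := by
  obtain ⟨r, f, hf⟩ := Module.Finite.exists_fin' A N
  refine ⟨r, f ∘ₗ (LinearEquiv.funCongrLeft A A Equiv.ulift.symm).toLinearMap, ?_⟩
  exact hf.comp (LinearEquiv.surjective _)

lemma canMap_surj (N : Type u) [AddCommGroup N] [Module A N] [Module.Finite A N] :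
    Function.Surjective (canMap (A := A) G N) := by
  obtain ⟨r, f, hf⟩ := exists_free_surj (A := A) N
  intro y
  choose z hz using fun i => LinearMap.lTensor_surjective (G i) hf (y i)
  obtain ⟨w, hw⟩ := (canMap_free G r).2 z
  refine ⟨LinearMap.lTensor _ f w, ?_⟩
  ext i
  rw [canMap_nat, hw, hz]

lemma canMap_inj [IsNoetherianRing A] (N : Type u) [AddCommGroup N] [Module A N]
    [Module.Finite A N] : Function.Injective (canMap (A := A) G N) := by
  obtain ⟨r, f, hf⟩ := exists_free_surj (A := A) N
  rw [injective_iff_map_eq_zero]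
  intro x hx
  obtain ⟨w, rfl⟩ := LinearMap.lTensor_surjective (∀ i, G i) hf x
  have hex : Function.Exact (LinearMap.ker f).subtype f := LinearMap.exact_subtype_ker_map f
  have h1 : ∀ i, ∃ z, LinearMap.lTensor (G i) (LinearMap.ker f).subtype z = canMap (A := A) G _ w i := by
    intro i
    refine (lTensor_exact (G i) hex hf _).1 ?_
    rw [← canMap_nat, hx]; rfl
  choose z hz using h1
  obtain ⟨t, ht⟩ := canMap_surj G (LinearMap.ker f) z
  have h2 : LinearMap.lTensor (∀ i, G i) (LinearMap.ker f).subtype t = w := by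
    apply (canMap_free G r).1
    ext i
    rw [canMap_nat, ht, hz]
  exact (lTensor_exact (∀ i, G i) hex hf _).2 ⟨t, h2⟩

lemma exists_lift [IsNoetherianRing A] (m : Ideal A)
    {E : Type u} [AddCommGroup E] [Module A E] (hE : IsInjectiveHull A (A ⧸ m) E)
    {P : Type u} [AddCommGroup P] [Module A P] (x : TensorProduct A P E) :
    ∃ n y, LinearMap.lTensor P (killed m E n).subtype y = x := by
  have mono : ∀ n k, n ≤ k → ∀ y : TensorProduct A P (killed m E n),
      ∃ z, LinearMap.lTensor P (killed m E k).subtype z =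
        LinearMap.lTensor P (killed m E n).subtype y := by
    intro n k h y
    refine ⟨LinearMap.lTensor P (Submodule.inclusion (killed_mono m E h)) y, ?_⟩
    rw [← LinearMap.comp_apply, ← LinearMap.lTensor_comp]
    rfl
  induction x using TensorProduct.induction_on with
  | zero => exact ⟨0, 0, map_zero _⟩
  | tmul p e =>
    obtain ⟨n, hn⟩ := aux_torsion m hE e
    exact ⟨n, p ⊗ₜ[A] ⟨e, hn⟩, rfl⟩
  | add a b ha hb =>
    obtain ⟨n, y, rfl⟩ := ha
    obtain ⟨k, z, rfl⟩ := hb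
    obtain ⟨y', hy'⟩ := mono n (max n k) (le_max_left _ _) y
    obtain ⟨z', hz'⟩ := mono k (max n k) (le_max_right _ _) z
    exact ⟨max n k, y' + z', by rw [map_add, hy', hz']⟩

lemma canMap_E_inj [IsNoetherianRing A] (m : Ideal A) (hm : m.IsMaximal)
    {E : Type u} [AddCommGroup E] [Module A E] (hE : IsInjectiveHull A (A ⧸ m) E)
    [∀ i, Module.Flat A (G i)] : Function.Injective (canMap (A := A) G E) := by
  rw [injective_iff_map_eq_zero]
  intro x hx
  obtain ⟨n, y, rfl⟩ := exists_lift m hE x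
  have : Module.Finite A (killed m E n) := Module.Finite.iff_fg.2 (killed_fg m hm hE n)
  have : y = 0 := by
    apply canMap_inj G (killed m E n)
    rw [map_zero]
    ext i
    apply Module.Flat.lTensor_preserves_injective_linearMap (M := G i) _
      (killed m E n).injective_subtype
    rw [← canMap_nat, hx, Pi.zero_apply, Pi.zero_apply, map_zero]
  rw [this, map_zero]

lemma canMap_mem [IsNoetherianRing A] (m : Ideal A)
    {E : Type u} [AddCommGroup E] [Module A E] (hE : IsInjectiveHull A (A ⧸ m) E)
    (x : TensorProduct A (∀ i, G i) E) :
    canMap (A := A) G E x ∈ torsionAt A m (∀ i, TensorProduct A (G i) E) := by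
  induction x using TensorProduct.induction_on with
  | zero => rw [map_zero]; exact zero_mem _
  | tmul p e =>
    obtain ⟨n, hn⟩ := aux_torsion m hE e
    refine ⟨n, fun a ha => ?_⟩
    rw [← map_smul, ← TensorProduct.tmul_smul, hn a ha, TensorProduct.tmul_zero, map_zero]
  | add a b ha hb => rw [map_add]; exact add_mem ha hb

lemma canMap_E_surj [IsNoetherianRing A] (m : Ideal A) (hm : m.IsMaximal)
    {E : Type u} [AddCommGroup E] [Module A E] (hE : IsInjectiveHull A (A ⧸ m) E)
    [∀ i, Module.Flat A (G i)] (y : ∀ i, TensorProduct A (G i) E)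
    (hy : y ∈ torsionAt A m (∀ i, TensorProduct A (G i) E)) : ∃ x, canMap (A := A) G E x = y := by
  obtain ⟨n, hn⟩ := hy
  have : Module.Finite A (killed m E n) := Module.Finite.iff_fg.2 (killed_fg m hm hE n)
  choose z hz using fun i => flat_killed m n E (G i) (y i) (fun a ha => congrFun (hn a ha) i)
  obtain ⟨w, hw⟩ := canMap_surj G (killed m E n) z
  refine ⟨LinearMap.lTensor _ (killed m E n).subtype w, ?_⟩
  ext i
  rw [canMap_nat, hw, hz]

/-- the isomorphism -/
noncomputable def canEquiv [IsNoetherianRing A] (m : Ideal A) (hm : m.IsMaximal)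
    {E : Type u} [AddCommGroup E] [Module A E] (hE : IsInjectiveHull A (A ⧸ m) E)
    [∀ i, Module.Flat A (G i)] :
    TensorProduct A (∀ i, G i) E ≃ₗ[A] torsionAt A m (∀ i, TensorProduct A (G i) E) :=
  LinearEquiv.ofBijective ((canMap (A := A) G E).codRestrict _ (canMap_mem G m hE))
    ⟨fun _ _ h => canMap_E_inj G m hm hE (congrArg Subtype.val h),
      fun ⟨y, hy⟩ => (canMap_E_surj G m hm hE y hy).imp fun _ h => Subtype.ext h⟩

lemma canMap_diff (H : ι → Type u) [∀ i, AddCommGroup (H i)] [∀ i, Module A (H i)]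
    {E : Type u} [AddCommGroup E] [Module A E]
    (d : ∀ i, G i →ₗ[A] H i) (x : TensorProduct A (∀ i, G i) E) (i : ι) :
    canMap H E (LinearMap.rTensor E (LinearMap.pi fun i => d i ∘ₗ LinearMap.proj i) x) i =
      LinearMap.rTensor E (d i) (canMap G E x i) := by
  induction x using TensorProduct.induction_on with
  | zero => simp
  | tmul f e => rfl
  | add a b ha hb => simp only [map_add, Pi.add_apply, ha, hb]

end

end Aux

/-- For a maximal ideal `m` of a commutative noetherian ring `A`, a family `Fᵢ` of complexes of
flat `A`-modules, and `E = E(A/m)` the injective hull of `A/m`, the complexes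
`(∏ᵢ Fᵢ) ⊗_A E(A/m)` and `Γ_m (∏ᵢ (Fᵢ ⊗_A E(A/m)))` are homotopy equivalent. -/
theorem prodTensor_homotopyEquiv_gammaProd
    (A : Type u) [CommRing A] [IsNoetherianRing A] (m : Ideal A) (hm : m.IsMaximal)
    (E : Type u) [AddCommGroup E] [Module A E] (hE : IsInjectiveHull A (A ⧸ m) E)
    (ι : Type u) (F : ι → ℤ → Type u) [∀ i n, AddCommGroup (F i n)] [∀ i n, Module A (F i n)]
    (d : ∀ i n, F i n →ₗ[A] F i (n + 1))
    (hflat : ∀ i n, Module.Flat A (F i n))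
    (hsq : ∀ i n (x : F i n), d i (n + 1) (d i n x) = 0) :
    ∃ (u : ∀ n, prodTensorObj A ι F E n →ₗ[A] gammaProdObj A m ι F E n)
      (v : ∀ n, gammaProdObj A m ι F E n →ₗ[A] prodTensorObj A ι F E n),
      IsChainMap A (prodTensorObj A ι F E) (prodTensorD A ι F d E)
        (gammaProdObj A m ι F E) (gammaProdD A m ι F d E) u ∧
      IsChainMap A (gammaProdObj A m ι F E) (gammaProdD A m ι F d E)
        (prodTensorObj A ι F E) (prodTensorD A ι F d E) v ∧
      ChainHomotopic A (prodTensorObj A ι F E) (prodTensorD A ι F d E)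
        (prodTensorObj A ι F E) (prodTensorD A ι F d E)
        (fun n => v n ∘ₗ u n) (fun n => LinearMap.id) ∧
      ChainHomotopic A (gammaProdObj A m ι F E) (gammaProdD A m ι F d E)
        (gammaProdObj A m ι F E) (gammaProdD A m ι F d E)
        (fun n => u n ∘ₗ v n) (fun n => LinearMap.id) := by
  let e : ∀ n, prodTensorObj A ι F E n ≃ₗ[A] gammaProdObj A m ι F E n := fun n =>
    haveI := fun i => hflat i n
    canEquiv (fun i => F i n) m hm hE
  have hu : ∀ n (x : prodTensorObj A ι F E n),
      e (n + 1) (prodTensorD A ι F d E n x) = gammaProdD A m ι F d E n (e n x) := by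
    intro n x
    apply Subtype.ext
    funext i
    exact canMap_diff (fun i => F i n) (fun i => F i (n + 1)) (fun i => d i n) x i
  refine ⟨fun n => (e n).toLinearMap, fun n => (e n).symm.toLinearMap, hu, ?_,
    ⟨fun n => 0, ?_⟩, ⟨fun n => 0, ?_⟩⟩
  · intro n x
    apply (e (n + 1)).injective
    have := hu n ((e n).symm x)
    simp only [LinearEquiv.coe_coe, LinearEquiv.apply_symm_apply] at this ⊢
    exact this.symm
  · intro n x
    simp
  · intro n x
    simp
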